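/- arXiv:1812.08648 — 8 statements merged into one kernel-verified Lean document; each statement's English description precedes it below -/
import Mathlib

section
/- Let U, V, W : ℝ³ → Matrix n n ℂ be smooth matrix-valued functions of the variables (ξ, η, ν). Suppose that on all of ℝ³, ∂_ν V − ∂_η W + [V, W] = 0 and ∂_ξ W − ∂_ν U + [W, U] = 0. Then the remaining curvature C := ∂_η U − ∂_ξ V + [U, V] satisfies ∂_ν C + [C, W] = 0 on all of ℝ³. (Multidimensional consistency of the zero-curvature relations.) -/
open Matrix

attribute [local instance] Matrix.linftyOpNormedAddCommGroup Matrix.linftyOpNormedSpace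
  Matrix.linftyOpNormedRing

/-- Partial derivative in the first of three real variables. -/
noncomputable def pdx {E : Type*} [NormedAddCommGroup E] [NormedSpace ℝ E]
    (f : ℝ → ℝ → ℝ → E) (x y z : ℝ) : E :=
  deriv (fun t => f t y z) x

/-- Partial derivative in the second of three real variables. -/
noncomputable def pdy {E : Type*} [NormedAddCommGroup E] [NormedSpace ℝ E]
    (f : ℝ → ℝ → ℝ → E) (x y z : ℝ) : E :=
  deriv (fun t => f x t z) y

/-- Partial derivative in the third of three real variables. -/
noncomputable def pdz {E : Type*} [NormedAddCommGroup E] [NormedSpace ℝ E]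
    (f : ℝ → ℝ → ℝ → E) (x y z : ℝ) : E :=
  deriv (fun t => f x y t) z

/-- Smoothness (infinite differentiability) of a function of three real variables. -/
def Smooth3 {E : Type*} [NormedAddCommGroup E] [NormedSpace ℝ E]
    (f : ℝ → ℝ → ℝ → E) : Prop :=
  ContDiff ℝ (⊤ : ℕ∞) (fun p : ℝ × ℝ × ℝ => f p.1 p.2.1 p.2.2)

section helpers

variable {E : Type*} [NormedAddCommGroup E] [NormedSpace ℝ E]

theorem aux_line {f : ℝ → ℝ → ℝ → E} (hf : Smooth3 f) (x y z : ℝ) :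
    HasDerivAt (fun t => f t y z)
      (fderiv ℝ (fun p : ℝ × ℝ × ℝ => f p.1 p.2.1 p.2.2) (x, y, z) (1, 0, 0)) x ∧
    HasDerivAt (fun t => f x t z)
      (fderiv ℝ (fun p : ℝ × ℝ × ℝ => f p.1 p.2.1 p.2.2) (x, y, z) (0, 1, 0)) y ∧
    HasDerivAt (fun t => f x y t)
      (fderiv ℝ (fun p : ℝ × ℝ × ℝ => f p.1 p.2.1 p.2.2) (x, y, z) (0, 0, 1)) z := by
  have hd : HasFDerivAt (fun p : ℝ × ℝ × ℝ => f p.1 p.2.1 p.2.2) _ (x, y, z) :=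
    ((hf.differentiable (by simp)) (x, y, z)).hasFDerivAt
  refine ⟨?_, ?_, ?_⟩
  · exact hd.comp_hasDerivAt (f := fun t : ℝ => (t, y, z)) x
      ((hasDerivAt_id x).prodMk ((hasDerivAt_const x y).prodMk (hasDerivAt_const x z)))
  · exact hd.comp_hasDerivAt (f := fun t : ℝ => (x, t, z)) y
      ((hasDerivAt_const y x).prodMk ((hasDerivAt_id y).prodMk (hasDerivAt_const y z)))
  · exact hd.comp_hasDerivAt (f := fun t : ℝ => (x, y, t)) z
      ((hasDerivAt_const z x).prodMk ((hasDerivAt_const z y).prodMk (hasDerivAt_id z)))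

theorem aux_pdx {f : ℝ → ℝ → ℝ → E} (hf : Smooth3 f) (x y z : ℝ) :
    HasDerivAt (fun t => f t y z) (pdx f x y z) x :=
  (aux_line hf x y z).1.differentiableAt.hasDerivAt

theorem aux_pdy {f : ℝ → ℝ → ℝ → E} (hf : Smooth3 f) (x y z : ℝ) :
    HasDerivAt (fun t => f x t z) (pdy f x y z) y :=
  (aux_line hf x y z).2.1.differentiableAt.hasDerivAt

theorem aux_pdz {f : ℝ → ℝ → ℝ → E} (hf : Smooth3 f) (x y z : ℝ) :
    HasDerivAt (fun t => f x y t) (pdz f x y z) z :=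
  (aux_line hf x y z).2.2.differentiableAt.hasDerivAt

theorem aux_fderiv_smooth {f : ℝ → ℝ → ℝ → E} (hf : Smooth3 f) (v : ℝ × ℝ × ℝ) :
    ContDiff ℝ (⊤ : ℕ∞)
      (fun p => fderiv ℝ (fun p : ℝ × ℝ × ℝ => f p.1 p.2.1 p.2.2) p v) :=
  (ContDiff.fderiv_right (m := (⊤ : ℕ∞)) hf (by simp)).clm_apply contDiff_const

theorem aux_sx {f : ℝ → ℝ → ℝ → E} (hf : Smooth3 f) : Smooth3 (pdx f) := by
  have := aux_fderiv_smooth hf (1, 0, 0)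
  unfold Smooth3
  convert this using 2 with p
  exact (aux_line hf p.1 p.2.1 p.2.2).1.deriv

theorem aux_sy {f : ℝ → ℝ → ℝ → E} (hf : Smooth3 f) : Smooth3 (pdy f) := by
  have := aux_fderiv_smooth hf (0, 1, 0)
  unfold Smooth3
  convert this using 2 with p
  exact (aux_line hf p.1 p.2.1 p.2.2).2.1.deriv

theorem aux_sz {f : ℝ → ℝ → ℝ → E} (hf : Smooth3 f) : Smooth3 (pdz f) := by
  have := aux_fderiv_smooth hf (0, 0, 1)
  unfold Smooth3
  convert this using 2 with p
  exact (aux_line hf p.1 p.2.1 p.2.2).2.2.deriv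

theorem aux_fd2 {f : ℝ → ℝ → ℝ → E} (hf : Smooth3 f) (p v w : ℝ × ℝ × ℝ) :
    fderiv ℝ (fun p => fderiv ℝ (fun p : ℝ × ℝ × ℝ => f p.1 p.2.1 p.2.2) p v) p w =
    fderiv ℝ (fun p => fderiv ℝ (fun p : ℝ × ℝ × ℝ => f p.1 p.2.1 p.2.2) p w) p v := by
  have hd : DifferentiableAt ℝ (fderiv ℝ (fun p : ℝ × ℝ × ℝ => f p.1 p.2.1 p.2.2)) p :=
    ((ContDiff.fderiv_right (m := (⊤ : ℕ∞)) hf (by simp)).differentiable (by simp)) p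
  have hs : IsSymmSndFDerivAt ℝ (fun p : ℝ × ℝ × ℝ => f p.1 p.2.1 p.2.2) p :=
    (ContDiff.contDiffAt hf).isSymmSndFDerivAt (by
      simp only [minSmoothness_of_isRCLikeNormedField]; exact WithTop.coe_le_coe.2 (le_top : (2 : ℕ∞) ≤ ⊤))
  rw [fderiv_clm_apply hd (by fun_prop), fderiv_clm_apply hd (by fun_prop)]
  simpa using hs w v

theorem aux_ex {f : ℝ → ℝ → ℝ → E} (hf : Smooth3 f) :
    (fun p : ℝ × ℝ × ℝ => pdx f p.1 p.2.1 p.2.2) =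
    (fun p => fderiv ℝ (fun p : ℝ × ℝ × ℝ => f p.1 p.2.1 p.2.2) p (1, 0, 0)) :=
  funext fun p => (aux_line hf p.1 p.2.1 p.2.2).1.deriv

theorem aux_ey {f : ℝ → ℝ → ℝ → E} (hf : Smooth3 f) :
    (fun p : ℝ × ℝ × ℝ => pdy f p.1 p.2.1 p.2.2) =
    (fun p => fderiv ℝ (fun p : ℝ × ℝ × ℝ => f p.1 p.2.1 p.2.2) p (0, 1, 0)) :=
  funext fun p => (aux_line hf p.1 p.2.1 p.2.2).2.1.deriv

theorem aux_ez {f : ℝ → ℝ → ℝ → E} (hf : Smooth3 f) :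
    (fun p : ℝ × ℝ × ℝ => pdz f p.1 p.2.1 p.2.2) =
    (fun p => fderiv ℝ (fun p : ℝ × ℝ × ℝ => f p.1 p.2.1 p.2.2) p (0, 0, 1)) :=
  funext fun p => (aux_line hf p.1 p.2.1 p.2.2).2.2.deriv

theorem aux_xy {f : ℝ → ℝ → ℝ → E} (hf : Smooth3 f) (x y z : ℝ) :
    pdx (pdy f) x y z = pdy (pdx f) x y z := by
  have a := (aux_line (aux_sy hf) x y z).1.deriv
  have b := (aux_line (aux_sx hf) x y z).2.1.deriv
  rw [aux_ey hf] at a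
  rw [aux_ex hf] at b
  exact a.trans ((aux_fd2 hf _ _ _).trans b.symm)

theorem aux_xz {f : ℝ → ℝ → ℝ → E} (hf : Smooth3 f) (x y z : ℝ) :
    pdx (pdz f) x y z = pdz (pdx f) x y z := by
  have a := (aux_line (aux_sz hf) x y z).1.deriv
  have b := (aux_line (aux_sx hf) x y z).2.2.deriv
  rw [aux_ez hf] at a
  rw [aux_ex hf] at b
  exact a.trans ((aux_fd2 hf _ _ _).trans b.symm)

theorem aux_yz {f : ℝ → ℝ → ℝ → E} (hf : Smooth3 f) (x y z : ℝ) :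
    pdy (pdz f) x y z = pdz (pdy f) x y z := by
  have a := (aux_line (aux_sz hf) x y z).2.1.deriv
  have b := (aux_line (aux_sy hf) x y z).2.2.deriv
  rw [aux_ez hf] at a
  rw [aux_ey hf] at b
  exact a.trans ((aux_fd2 hf _ _ _).trans b.symm)

end helpers

theorem aux_general {A : Type*} [NormedRing A] [NormedAlgebra ℝ A]
    (U V W : ℝ → ℝ → ℝ → A)
    (hU : Smooth3 U) (hV : Smooth3 V) (hW : Smooth3 W)
    (h1 : ∀ ξ η ν, pdz V ξ η ν - pdy W ξ η ν
      + (V ξ η ν * W ξ η ν - W ξ η ν * V ξ η ν) = 0)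
    (h2 : ∀ ξ η ν, pdx W ξ η ν - pdz U ξ η ν
      + (W ξ η ν * U ξ η ν - U ξ η ν * W ξ η ν) = 0) :
    ∀ ξ η ν,
      pdz (fun ξ η ν => pdy U ξ η ν - pdx V ξ η ν
          + (U ξ η ν * V ξ η ν - V ξ η ν * U ξ η ν)) ξ η ν
        + ((pdy U ξ η ν - pdx V ξ η ν + (U ξ η ν * V ξ η ν - V ξ η ν * U ξ η ν)) * W ξ η ν
          - W ξ η ν * (pdy U ξ η ν - pdx V ξ η ν
            + (U ξ η ν * V ξ η ν - V ξ η ν * U ξ η ν))) = 0 := by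
  intro x y z
  have e1 : pdz V = fun x y z => pdy W x y z - (V x y z * W x y z - W x y z * V x y z) := by
    funext x y z
    have := h1 x y z
    rw [← sub_eq_zero, ← this]; abel
  have e2 : pdz U = fun x y z => pdx W x y z + (W x y z * U x y z - U x y z * W x y z) := by
    funext x y z
    have := h2 x y z
    rw [← sub_eq_zero, ← neg_eq_zero, ← this]; abel
  have k1 := (aux_xz hV x y z).symm
  have m1 := ((aux_pdx (aux_sy hW) x y z).sub
      (((aux_pdx hV x y z).mul (aux_pdx hW x y z)).sub
        ((aux_pdx hW x y z).mul (aux_pdx hV x y z)))).deriv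
  have k2 := (aux_yz hU x y z).symm
  have m2 := ((aux_pdy (aux_sx hW) x y z).add
      (((aux_pdy hW x y z).mul (aux_pdy hU x y z)).sub
        ((aux_pdy hU x y z).mul (aux_pdy hW x y z)))).deriv
  rw [e1] at k1
  rw [e2] at k2
  replace k1 := k1.trans m1
  replace k2 := k2.trans m2
  have k := (((aux_pdz (aux_sy hU) x y z).sub (aux_pdz (aux_sx hV) x y z)).add
      (((aux_pdz hU x y z).mul (aux_pdz hV x y z)).sub
        ((aux_pdz hV x y z).mul (aux_pdz hU x y z)))).deriv
  refine (congrArg (· + _) k).trans ?_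
  rw [k1, k2, aux_xy hW, e1, e2]
  noncomm_ring

/-- Multidimensional consistency of the zero-curvature relations: if the
`(η,ν)` and `(ν,ξ)` curvatures vanish identically, then the remaining curvature
`C = ∂_η U − ∂_ξ V + [U,V]` satisfies `∂_ν C + [C,W] = 0`. -/
theorem zero_curvature_consistency {n : Type*} [Fintype n] [DecidableEq n]
    (U V W : ℝ → ℝ → ℝ → Matrix n n ℂ)
    (hU : Smooth3 U) (hV : Smooth3 V) (hW : Smooth3 W)
    (h1 : ∀ ξ η ν, pdz V ξ η ν - pdy W ξ η ν
      + (V ξ η ν * W ξ η ν - W ξ η ν * V ξ η ν) = 0)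
    (h2 : ∀ ξ η ν, pdx W ξ η ν - pdz U ξ η ν
      + (W ξ η ν * U ξ η ν - U ξ η ν * W ξ η ν) = 0) :
    ∀ ξ η ν,
      pdz (fun ξ η ν => pdy U ξ η ν - pdx V ξ η ν
          + (U ξ η ν * V ξ η ν - V ξ η ν * U ξ η ν)) ξ η ν
        + ((pdy U ξ η ν - pdx V ξ η ν + (U ξ η ν * V ξ η ν - V ξ η ν * U ξ η ν)) * W ξ η ν
          - W ξ η ν * (pdy U ξ η ν - pdx V ξ η ν
            + (U ξ η ν * V ξ η ν - V ξ η ν * U ξ η ν))) = 0 := by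
  letI : NormedAlgebra ℝ (Matrix n n ℂ) := Matrix.linftyOpNormedAlgebra
  exact aux_general U V W hU hV hW h1 h2
end

section
/- Let A, M, Y : ℝ → Matrix n n ℂ with Y, M differentiable, Y(t) invertible for every t, Y′(t) = A(t) · Y(t) and M′(t) = [A(t), M(t)] for all t. Then the characteristic polynomial of M(t) equals the characteristic polynomial of M(0) for every t ∈ ℝ; in particular the eigenvalues of M(t) do not depend on t. (Isospectrality: the eigenvalues of Uⁱ do not depend on η.) -/
open Matrix

attribute [local instance] Matrix.linftyOpNormedAddCommGroup Matrix.linftyOpNormedSpace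
  Matrix.linftyOpNormedRing

theorem conj_const_aux {R : Type*} [NormedRing R] [NormedAlgebra ℝ R] [CompleteSpace R]
    (A M Y : ℝ → R)
    (hY : ∀ t, HasDerivAt Y (A t * Y t) t)
    (hM : ∀ t, HasDerivAt M (A t * M t - M t * A t) t)
    (hYinv : ∀ t, IsUnit (Y t)) (t : ℝ)
    (X X0 : R) (hX : X * Y t = 1) (hX0 : X0 * Y 0 = 1) :
    X * M t * Y t = X0 * M 0 * Y 0 := by
  have key : ∀ t, HasDerivAt (fun s => Ring.inverse (Y s) * M s * Y s) 0 t := by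
    intro t
    obtain ⟨u, hu⟩ := hYinv t
    have h1 : HasDerivAt (fun s => Ring.inverse (Y s)) (-(Ring.inverse (Y t) * A t)) t := by
      have h := hasFDerivAt_ringInverse (𝕜 := ℝ) u
      rw [hu] at h
      have h2 := h.comp_hasDerivAt t (hY t)
      have e : (-((ContinuousLinearMap.mulLeftRight ℝ R) ↑u⁻¹) ↑u⁻¹) (A t * Y t)
          = -(Ring.inverse (Y t) * A t) := by
        rw [← hu, Ring.inverse_unit]
        simp [mul_assoc]
      rw [e] at h2
      exact h2
    have h3 := (h1.mul (hM t)).mul (hY t)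
    have e : (-(Ring.inverse (Y t) * A t) * M t +
        Ring.inverse (Y t) * (A t * M t - M t * A t)) * Y t +
        (Ring.inverse (Y t) * M t) * (A t * Y t) = 0 := by
      noncomm_ring
    simp only [Pi.mul_apply] at h3
    rw [e] at h3
    exact h3
  have hI : ∀ t (X : R), X * Y t = 1 → Ring.inverse (Y t) = X := by
    intro t X hX
    obtain ⟨u, hu⟩ := hYinv t
    rw [← hu] at hX ⊢
    rw [Ring.inverse_unit]
    exact (Units.eq_inv_of_mul_eq_one_right hX).symm
  rw [← hI t X hX, ← hI 0 X0 hX0]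
  exact is_const_of_deriv_eq_zero (fun t => (key t).differentiableAt)
    (fun t => (key t).deriv) t 0

/-- Isospectrality: if `Y' = A Y` with `Y` everywhere invertible and
`M' = [A, M]`, then the characteristic polynomial of `M t` is independent of `t`. -/
theorem isospectral_charpoly {n : Type*} [Fintype n] [DecidableEq n]
    (A M Y : ℝ → Matrix n n ℂ)
    (hY : Differentiable ℝ Y) (hM : Differentiable ℝ M)
    (hYinv : ∀ t, IsUnit (Y t))
    (hYeq : ∀ t, deriv Y t = A t * Y t)
    (hMeq : ∀ t, deriv M t = A t * M t - M t * A t) :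
    ∀ t : ℝ, (M t).charpoly = (M 0).charpoly := by
  intro t
  obtain ⟨u, hu⟩ := hYinv t
  obtain ⟨v, hv⟩ := hYinv 0
  have hX : (↑u⁻¹ : Matrix n n ℂ) * Y t = 1 := by rw [← hu, Units.inv_mul]
  have hX0 : (↑v⁻¹ : Matrix n n ℂ) * Y 0 = 1 := by rw [← hv, Units.inv_mul]
  have h : (↑u⁻¹ : Matrix n n ℂ) * M t * Y t = (↑v⁻¹ : Matrix n n ℂ) * M 0 * Y 0 := by
    let _ : NormedAlgebra ℝ (Matrix n n ℂ) := Matrix.linftyOpNormedAlgebra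
    have _ : CompleteSpace (Matrix n n ℂ) := FiniteDimensional.complete ℝ _
    exact conj_const_aux A M Y (fun t => hYeq t ▸ (hY t).hasDerivAt)
      (fun t => hMeq t ▸ (hM t).hasDerivAt) hYinv t _ _ hX hX0
  rw [← hu, ← hv, Matrix.coe_units_inv, Matrix.coe_units_inv] at h
  rw [← Matrix.charpoly_units_conj' u (M t), ← Matrix.charpoly_units_conj' v (M 0)]
  exact congrArg Matrix.charpoly h
end

section
/- Let a₁, …, a_{N₁}, b₁, …, b_{N₂} ∈ ℂ be pairwise distinct (in particular aᵢ ≠ b_j for all i, j). Let U⁰, V⁰, Uⁱ (1 ≤ i ≤ N₁), Vʲ (1 ≤ j ≤ N₂) : ℝ² → Matrix n n ℂ be differentiable functions of (ξ, η). For λ ∈ ℂ ∖ ({aᵢ} ∪ {b_j}) set U(λ) := U⁰ + Σᵢ Uⁱ/(λ − aᵢ) and V(λ) := V⁰ + Σⱼ Vʲ/(λ − b_j). Then the zero-curvature equation ∂_η U(λ) − ∂_ξ V(λ) + [U(λ), V(λ)] = 0 holds for every such λ and every (ξ, η) if and only if the following hold on ℝ²: (i) ∂_η U⁰ − ∂_ξ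 V⁰ + [U⁰, V⁰] = 0; (ii) for each i, ∂_η Uⁱ + [Uⁱ, V⁰ + Σⱼ Vʲ/(aᵢ − b_j)] = 0; (iii) for each j, ∂_ξ Vʲ + [Vʲ, U⁰ + Σᵢ Uⁱ/(b_j − aᵢ)] = 0. -/
open Matrix

attribute [local instance] Matrix.linftyOpNormedAddCommGroup Matrix.linftyOpNormedSpace
  Matrix.linftyOpNormedRing

/-- Partial derivative in the first of two real variables. -/
noncomputable def pd1 {E : Type*} [NormedAddCommGroup E] [NormedSpace ℝ E]
    (f : ℝ → ℝ → E) (x y : ℝ) : E :=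
  deriv (fun t => f t y) x

/-- Partial derivative in the second of two real variables. -/
noncomputable def pd2 {E : Type*} [NormedAddCommGroup E] [NormedSpace ℝ E]
    (f : ℝ → ℝ → E) (x y : ℝ) : E :=
  deriv (fun t => f x t) y

/-- Differentiability of a function of two real variables. -/
def Diff2 {E : Type*} [NormedAddCommGroup E] [NormedSpace ℝ E]
    (f : ℝ → ℝ → E) : Prop :=
  Differentiable ℝ (fun p : ℝ × ℝ => f p.1 p.2)

open Polynomial in
theorem pf_unique {ι : Type*} [Fintype ι] [DecidableEq ι] (c : ι → ℂ)
    (hc : Function.Injective c) (C : ℂ) (A : ι → ℂ)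
    (h : ∀ z : ℂ, (∀ k, z ≠ c k) → C + ∑ k, (z - c k)⁻¹ * A k = 0) :
    C = 0 ∧ ∀ k, A k = 0 := by
  set P : ℂ[X] := Polynomial.C C * ∏ l, (X - Polynomial.C (c l))
    + ∑ k, Polynomial.C (A k) * ∏ l ∈ Finset.univ.erase k, (X - Polynomial.C (c l)) with hP
  have hP0 : P = 0 := by
    apply Polynomial.eq_zero_of_infinite_isRoot
    refine Set.Infinite.mono (s := (Set.range c)ᶜ) ?_ (Set.finite_range c).infinite_compl
    intro z hz
    have hz' : ∀ k, z ≠ c k := fun k hk => hz ⟨k, hk.symm⟩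
    have h0 := h z hz'
    have e : P.eval z = (C + ∑ k, (z - c k)⁻¹ * A k) * ∏ l, (z - c l) := by
      simp only [hP, eval_add, eval_mul, eval_C, eval_finsetSum, eval_prod, eval_sub, eval_X,
        add_mul, Finset.sum_mul]
      congr 1
      refine Finset.sum_congr rfl fun k _ => ?_
      rw [← Finset.mul_prod_erase Finset.univ (fun l => z - c l) (Finset.mem_univ k)]
      have := sub_ne_zero.mpr (hz' k)
      field_simp
    show P.eval z = 0
    rw [e, h0, zero_mul]
  have hA : ∀ k, A k = 0 := by
    intro k
    have e : P.eval (c k) = 0 := by rw [hP0, eval_zero]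
    simp only [hP, eval_add, eval_mul, eval_C, eval_finsetSum, eval_prod, eval_sub, eval_X] at e
    rw [Finset.prod_eq_zero (Finset.mem_univ k) (sub_self _), mul_zero, zero_add,
      Finset.sum_eq_single k] at e
    · rcases mul_eq_zero.mp e with e | e
      · exact e
      · obtain ⟨l, hl, h2⟩ := Finset.prod_eq_zero_iff.mp e
        exact absurd (hc (sub_eq_zero.mp h2)).symm (Finset.ne_of_mem_erase hl)
    · intro m _ hm
      rw [Finset.prod_eq_zero (Finset.mem_erase.mpr ⟨hm.symm, Finset.mem_univ k⟩) (sub_self _),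
        mul_zero]
    · simp
  refine ⟨?_, hA⟩
  obtain ⟨z, hz⟩ := (Set.finite_range c).infinite_compl.nonempty
  have := h z (fun k hk => hz ⟨k, hk.symm⟩)
  simpa [hA] using this

theorem alg_id {M : Type*} [Ring M] [Algebra ℂ M] {N1 N2 : ℕ} (a : Fin N1 → ℂ) (b : Fin N2 → ℂ)
    (hab : ∀ i j, a i ≠ b j) (z : ℂ) (hza : ∀ i, z ≠ a i) (hzb : ∀ j, z ≠ b j)
    (u v du dv : M) (U dU : Fin N1 → M) (V dV : Fin N2 → M) :
    (du + ∑ i, (z - a i)⁻¹ • dU i) - (dv + ∑ j, (z - b j)⁻¹ • dV j)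
      + ((u + ∑ i, (z - a i)⁻¹ • U i) * (v + ∑ j, (z - b j)⁻¹ • V j)
        - (v + ∑ j, (z - b j)⁻¹ • V j) * (u + ∑ i, (z - a i)⁻¹ • U i))
    = (du - dv + (u * v - v * u))
      + (∑ i, (z - a i)⁻¹ • (dU i + (U i * (v + ∑ j, (a i - b j)⁻¹ • V j)
          - (v + ∑ j, (a i - b j)⁻¹ • V j) * U i))
      + ∑ j, (z - b j)⁻¹ • (-(dV j + (V j * (u + ∑ i, (b j - a i)⁻¹ • U i)
          - (u + ∑ i, (b j - a i)⁻¹ • U i) * V j)))) := by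
  have key : ∀ i j, (z - a i)⁻¹ * (z - b j)⁻¹
      = (z - a i)⁻¹ * (a i - b j)⁻¹ + (z - b j)⁻¹ * (b j - a i)⁻¹ := by
    intro i j
    have h1 := sub_ne_zero.mpr (hza i)
    have h2 := sub_ne_zero.mpr (hzb j)
    have h3 := sub_ne_zero.mpr (hab i j)
    rw [← neg_sub (a i) (b j), inv_neg]
    field_simp
    ring
  have e1 : (∑ i, (z - a i)⁻¹ • U i) * (∑ j, (z - b j)⁻¹ • V j)
      = ∑ i, (z - a i)⁻¹ • (U i * ∑ j, (a i - b j)⁻¹ • V j)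
        + ∑ j, (z - b j)⁻¹ • ((∑ i, (b j - a i)⁻¹ • U i) * V j) := by
    simp only [Finset.mul_sum, Finset.sum_mul, Finset.smul_sum, smul_mul_assoc, mul_smul_comm,
      smul_smul]
    rw [Finset.sum_comm (s := (Finset.univ : Finset (Fin N2))) (t := Finset.univ)]
    try rw [Finset.sum_comm (s := (Finset.univ : Finset (Fin N2))) (t := Finset.univ)]
    rw [← Finset.sum_add_distrib]
    refine Finset.sum_congr rfl fun i _ => ?_
    rw [← Finset.sum_add_distrib]
    refine Finset.sum_congr rfl fun j _ => ?_
    rw [← add_smul, ← key, mul_comm]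
  have e2 : (∑ j, (z - b j)⁻¹ • V j) * (∑ i, (z - a i)⁻¹ • U i)
      = ∑ i, (z - a i)⁻¹ • ((∑ j, (a i - b j)⁻¹ • V j) * U i)
        + ∑ j, (z - b j)⁻¹ • (V j * ∑ i, (b j - a i)⁻¹ • U i) := by
    simp only [Finset.mul_sum, Finset.sum_mul, Finset.smul_sum, smul_mul_assoc, mul_smul_comm,
      smul_smul]
    rw [Finset.sum_comm (s := (Finset.univ : Finset (Fin N2))) (t := Finset.univ)]
    try rw [Finset.sum_comm (s := (Finset.univ : Finset (Fin N2))) (t := Finset.univ)]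
    rw [← Finset.sum_add_distrib]
    refine Finset.sum_congr rfl fun i _ => ?_
    rw [← Finset.sum_add_distrib]
    refine Finset.sum_congr rfl fun j _ => ?_
    rw [← add_smul, ← key, mul_comm]
  have e3 : u * (∑ j, (z - b j)⁻¹ • V j) = ∑ j, (z - b j)⁻¹ • (u * V j) := by
    simp only [Finset.mul_sum, mul_smul_comm]
  have e4 : (∑ j, (z - b j)⁻¹ • V j) * u = ∑ j, (z - b j)⁻¹ • (V j * u) := by
    simp only [Finset.sum_mul, smul_mul_assoc]
  have e5 : v * (∑ i, (z - a i)⁻¹ • U i) = ∑ i, (z - a i)⁻¹ • (v * U i) := by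
    simp only [Finset.mul_sum, mul_smul_comm]
  have e6 : (∑ i, (z - a i)⁻¹ • U i) * v = ∑ i, (z - a i)⁻¹ • (U i * v) := by
    simp only [Finset.sum_mul, smul_mul_assoc]
  simp only [mul_add, add_mul, e1, e2, e3, e4, e5, e6, smul_add, smul_sub, smul_neg,
    Finset.sum_add_distrib, Finset.sum_sub_distrib, Finset.sum_neg_distrib]
  abel

theorem Diff2.d1 {E : Type*} [NormedAddCommGroup E] [NormedSpace ℝ E] {f : ℝ → ℝ → E}
    (h : Diff2 f) (x y : ℝ) : DifferentiableAt ℝ (fun t => f t y) x :=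
  (h (x, y)).comp (f := fun t : ℝ => (t, y)) x (by fun_prop)

theorem Diff2.d2 {E : Type*} [NormedAddCommGroup E] [NormedSpace ℝ E] {f : ℝ → ℝ → E}
    (h : Diff2 f) (x y : ℝ) : DifferentiableAt ℝ (fun t => f x t) y :=
  (h (x, y)).comp (f := fun t : ℝ => (x, t)) y (by fun_prop)

theorem deriv_lin {n : Type*} [Fintype n] [DecidableEq n] {N : ℕ} (c : Fin N → ℂ)
    (f : ℝ → Matrix n n ℂ) (F : Fin N → ℝ → Matrix n n ℂ) (x : ℝ)
    (hf : DifferentiableAt ℝ f x) (hF : ∀ i, DifferentiableAt ℝ (F i) x) :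
    deriv (fun t => f t + ∑ i, c i • F i t) x = deriv f x + ∑ i, c i • deriv (F i) x := by
  refine HasDerivAt.deriv ?_
  refine hf.hasDerivAt.add ?_
  refine HasDerivAt.fun_sum fun i _ => ?_
  exact (hF i).hasDerivAt.const_smul (c i)

/-- The zero-curvature equation for rational Lax matrices with simple poles holds for
every non-pole value of the spectral parameter iff the residue equations
(comp1) and (comp2) of Zakharov–Mikhailov hold. -/
theorem zero_curvature_iff_residue_equations {n : Type*} [Fintype n] [DecidableEq n]
    {N1 N2 : ℕ} (a : Fin N1 → ℂ) (b : Fin N2 → ℂ)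
    (ha : Function.Injective a) (hb : Function.Injective b)
    (hab : ∀ i j, a i ≠ b j)
    (U0 V0 : ℝ → ℝ → Matrix n n ℂ)
    (U : Fin N1 → ℝ → ℝ → Matrix n n ℂ) (V : Fin N2 → ℝ → ℝ → Matrix n n ℂ)
    (hU0 : Diff2 U0) (hV0 : Diff2 V0)
    (hU : ∀ i, Diff2 (U i)) (hV : ∀ j, Diff2 (V j)) :
    (∀ lam : ℂ, (∀ i, lam ≠ a i) → (∀ j, lam ≠ b j) → ∀ ξ η : ℝ,
        pd2 (fun ξ η => U0 ξ η + ∑ i, (lam - a i)⁻¹ • U i ξ η) ξ η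
        - pd1 (fun ξ η => V0 ξ η + ∑ j, (lam - b j)⁻¹ • V j ξ η) ξ η
        + ((U0 ξ η + ∑ i, (lam - a i)⁻¹ • U i ξ η)
            * (V0 ξ η + ∑ j, (lam - b j)⁻¹ • V j ξ η)
          - (V0 ξ η + ∑ j, (lam - b j)⁻¹ • V j ξ η)
            * (U0 ξ η + ∑ i, (lam - a i)⁻¹ • U i ξ η)) = 0)
    ↔ ((∀ ξ η : ℝ, pd2 U0 ξ η - pd1 V0 ξ η
          + (U0 ξ η * V0 ξ η - V0 ξ η * U0 ξ η) = 0)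
      ∧ (∀ i, ∀ ξ η : ℝ, pd2 (U i) ξ η
          + (U i ξ η * (V0 ξ η + ∑ j, (a i - b j)⁻¹ • V j ξ η)
            - (V0 ξ η + ∑ j, (a i - b j)⁻¹ • V j ξ η) * U i ξ η) = 0)
      ∧ (∀ j, ∀ ξ η : ℝ, pd1 (V j) ξ η
          + (V j ξ η * (U0 ξ η + ∑ i, (b j - a i)⁻¹ • U i ξ η)
            - (U0 ξ η + ∑ i, (b j - a i)⁻¹ • U i ξ η) * V j ξ η) = 0)) := by
  have step : ∀ lam : ℂ, (∀ i, lam ≠ a i) → (∀ j, lam ≠ b j) → ∀ ξ η : ℝ,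
        pd2 (fun ξ η => U0 ξ η + ∑ i, (lam - a i)⁻¹ • U i ξ η) ξ η
        - pd1 (fun ξ η => V0 ξ η + ∑ j, (lam - b j)⁻¹ • V j ξ η) ξ η
        + ((U0 ξ η + ∑ i, (lam - a i)⁻¹ • U i ξ η)
            * (V0 ξ η + ∑ j, (lam - b j)⁻¹ • V j ξ η)
          - (V0 ξ η + ∑ j, (lam - b j)⁻¹ • V j ξ η)
            * (U0 ξ η + ∑ i, (lam - a i)⁻¹ • U i ξ η))
      = (pd2 U0 ξ η - pd1 V0 ξ η + (U0 ξ η * V0 ξ η - V0 ξ η * U0 ξ η))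
      + (∑ i, (lam - a i)⁻¹ • (pd2 (U i) ξ η
          + (U i ξ η * (V0 ξ η + ∑ j, (a i - b j)⁻¹ • V j ξ η)
            - (V0 ξ η + ∑ j, (a i - b j)⁻¹ • V j ξ η) * U i ξ η))
      + ∑ j, (lam - b j)⁻¹ • (-(pd1 (V j) ξ η
          + (V j ξ η * (U0 ξ η + ∑ i, (b j - a i)⁻¹ • U i ξ η)
            - (U0 ξ η + ∑ i, (b j - a i)⁻¹ • U i ξ η) * V j ξ η)))) := by
    intro z hza hzb ξ η
    have p2 : pd2 (fun ξ η => U0 ξ η + ∑ i, (z - a i)⁻¹ • U i ξ η) ξ η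
        = pd2 U0 ξ η + ∑ i, (z - a i)⁻¹ • pd2 (U i) ξ η :=
      deriv_lin (fun i => (z - a i)⁻¹) (fun t => U0 ξ t) (fun i t => U i ξ t) η
        (hU0.d2 ξ η) (fun i => (hU i).d2 ξ η)
    have p1 : pd1 (fun ξ η => V0 ξ η + ∑ j, (z - b j)⁻¹ • V j ξ η) ξ η
        = pd1 V0 ξ η + ∑ j, (z - b j)⁻¹ • pd1 (V j) ξ η :=
      deriv_lin (fun j => (z - b j)⁻¹) (fun t => V0 t η) (fun j t => V j t η) ξ
        (hV0.d1 ξ η) (fun j => (hV j).d1 ξ η)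
    rw [p2, p1]
    exact alg_id a b hab z hza hzb (U0 ξ η) (V0 ξ η) (pd2 U0 ξ η) (pd1 V0 ξ η)
      (fun i => U i ξ η) (fun i => pd2 (U i) ξ η) (fun j => V j ξ η) (fun j => pd1 (V j) ξ η)
  constructor
  · intro h
    have hc : Function.Injective (Sum.elim a b) := ha.sumElim hb hab
    have main : ∀ ξ η : ℝ, ∀ p q : n, _ := fun ξ η p q =>
      pf_unique (Sum.elim a b) hc
        ((pd2 U0 ξ η - pd1 V0 ξ η + (U0 ξ η * V0 ξ η - V0 ξ η * U0 ξ η)) p q)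
        (Sum.elim (fun i => (pd2 (U i) ξ η
          + (U i ξ η * (V0 ξ η + ∑ j, (a i - b j)⁻¹ • V j ξ η)
            - (V0 ξ η + ∑ j, (a i - b j)⁻¹ • V j ξ η) * U i ξ η)) p q)
          (fun j => (-(pd1 (V j) ξ η
          + (V j ξ η * (U0 ξ η + ∑ i, (b j - a i)⁻¹ • U i ξ η)
            - (U0 ξ η + ∑ i, (b j - a i)⁻¹ • U i ξ η) * V j ξ η))) p q))
        (by
          intro z hz
          have hza : ∀ i, z ≠ a i := fun i => hz (Sum.inl i)
          have hzb : ∀ j, z ≠ b j := fun j => hz (Sum.inr j)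
          have h1 := (step z hza hzb ξ η).symm.trans (h z hza hzb ξ η)
          have h2 := congrFun (congrFun h1 p) q
          rw [Matrix.add_apply, Matrix.add_apply _ _ p q, Matrix.add_apply (∑ i, _) _ p q,
            Matrix.sum_apply, Matrix.sum_apply] at h2
          rw [Fintype.sum_sum_type]
          exact h2)
    refine ⟨fun ξ η => ?_, fun i ξ η => ?_, fun j ξ η => ?_⟩
    · ext p q
      exact (main ξ η p q).1
    · ext p q
      exact (main ξ η p q).2 (Sum.inl i)
    · rw [← neg_eq_zero]
      ext p q
      exact (main ξ η p q).2 (Sum.inr j)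
  · rintro ⟨h0, h1, h2⟩ z hza hzb ξ η
    rw [step z hza hzb ξ η, h0]
    simp only [h1, h2, neg_zero, smul_zero, Finset.sum_const_zero, add_zero]
end

section
/- Let φ : ℝ² → Matrix n n ℂ be differentiable with φ(ξ, η) invertible everywhere, let Ū : ℝ² → Matrix n n ℂ be differentiable with ∂_η Ū = 0, and let V : ℝ² → Matrix n n ℂ be continuous. Suppose ∂_η φ = V · φ on ℝ². Then U := φ · Ū · φ⁻¹ satisfies ∂_η U = [V, U] on ℝ². -/
open Matrix

attribute [local instance] Matrix.linftyOpNormedAddCommGroup Matrix.linftyOpNormedSpace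
  Matrix.linftyOpNormedRing

/-- If `φ_η = V φ` and `Ubar` is independent of `η`, then `U = φ Ubar φ⁻¹` satisfies
`∂_η U = [V, U]`. -/
theorem conjugated_matrix_evolution {n : Type*} [Fintype n] [DecidableEq n]
    (φ Ubar V : ℝ → ℝ → Matrix n n ℂ)
    (hφ : Differentiable ℝ (fun p : ℝ × ℝ => φ p.1 p.2))
    (hφinv : ∀ ξ η, IsUnit (φ ξ η))
    (hUbar : Differentiable ℝ (fun p : ℝ × ℝ => Ubar p.1 p.2))
    (hUbarη : ∀ ξ η, pd2 Ubar ξ η = 0)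
    (hV : Continuous (fun p : ℝ × ℝ => V p.1 p.2))
    (hφeq : ∀ ξ η, pd2 φ ξ η = V ξ η * φ ξ η) :
    ∀ ξ η, pd2 (fun ξ η => φ ξ η * Ubar ξ η * (φ ξ η)⁻¹) ξ η
      = V ξ η * (φ ξ η * Ubar ξ η * (φ ξ η)⁻¹)
        - (φ ξ η * Ubar ξ η * (φ ξ η)⁻¹) * V ξ η := by
  intro ξ η
  let _ : NormedAlgebra ℝ (Matrix n n ℂ) := Matrix.linftyOpNormedAlgebra
  have hpair : DifferentiableAt ℝ (fun t : ℝ => ((ξ, t) : ℝ × ℝ)) η := by fun_prop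
  have h1 : HasDerivAt (fun t => φ ξ t) (V ξ η * φ ξ η) η := by
    rw [← hφeq ξ η]
    exact (DifferentiableAt.comp η (hφ (ξ, η)) hpair).hasDerivAt
  have h2 : HasDerivAt (fun t => Ubar ξ t) 0 η := by
    rw [← hUbarη ξ η]
    exact (DifferentiableAt.comp η (hUbar (ξ, η)) hpair).hasDerivAt
  obtain ⟨u, hu⟩ := hφinv ξ η
  have huinv : (φ ξ η)⁻¹ = ((u⁻¹ : (Matrix n n ℂ)ˣ) : Matrix n n ℂ) := by
    rw [← hu, Matrix.coe_units_inv]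
  have h3 : HasDerivAt (fun t => (φ ξ t)⁻¹)
      (-((φ ξ η)⁻¹ * (V ξ η * φ ξ η) * (φ ξ η)⁻¹)) η := by
    have hr := hasFDerivAt_ringInverse (𝕜 := ℝ) u
    rw [hu] at hr
    have := hr.comp_hasDerivAt η h1
    simp only [Matrix.nonsing_inv_eq_ringInverse] at huinv ⊢
    rw [huinv]
    exact this
  have h4 := (h1.mul h2).mul h3
  refine h4.deriv.trans ?_
  have e : φ ξ η * (φ ξ η)⁻¹ = 1 := by rw [huinv, ← hu, Units.mul_inv]
  simp only [Pi.mul_apply, mul_zero, add_zero, mul_neg, sub_eq_add_neg]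
  simp only [mul_assoc, e, mul_one]
end

section
/- Let φ : ℝ² → Matrix n n ℂ be differentiable with φ invertible everywhere, let Ū : ℝ² → Matrix n n ℂ be differentiable with ∂_η Ū = 0, and let M : ℝ² → Matrix n n ℂ be continuous. Set U := φ · Ū · φ⁻¹ and define E := −φ⁻¹ · (∂_η φ − M·φ) · Ū · φ⁻¹ + Ū · φ⁻¹ · (∂_η φ − M·φ) · φ⁻¹. Then E = −φ⁻¹ · (∂_η U + [U, M]); in particular, at each point E = 0 if and only if ∂_η U + [U, M] = 0. (The Euler–Lagrange equation δL/δφⁱ = 0 of the Zakharov–Mikhailov Lagrangian is equivalent to the compatibility condition \eqref{comp2}.) -/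
open Matrix

attribute [local instance] Matrix.linftyOpNormedAddCommGroup Matrix.linftyOpNormedSpace
  Matrix.linftyOpNormedRing

/-- The Euler–Lagrange expression obtained by varying `φ` in the
Zakharov–Mikhailov Lagrangian equals `−φ⁻¹ (∂_η U + [U, M])` where
`U = φ Ū φ⁻¹`; in particular it vanishes iff `∂_η U + [U, M] = 0`. -/
theorem ZM_EL_equiv_compatibility {n : Type*} [Fintype n] [DecidableEq n]
    (φ Ubar M : ℝ → ℝ → Matrix n n ℂ)
    (hφ : Differentiable ℝ (fun p : ℝ × ℝ => φ p.1 p.2))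
    (hφinv : ∀ ξ η, IsUnit (φ ξ η))
    (hUbar : Differentiable ℝ (fun p : ℝ × ℝ => Ubar p.1 p.2))
    (hUbarη : ∀ ξ η, pd2 Ubar ξ η = 0)
    (hM : Continuous (fun p : ℝ × ℝ => M p.1 p.2)) :
    ∀ ξ η,
      (-((φ ξ η)⁻¹ * (pd2 φ ξ η - M ξ η * φ ξ η) * Ubar ξ η * (φ ξ η)⁻¹)
          + Ubar ξ η * (φ ξ η)⁻¹ * (pd2 φ ξ η - M ξ η * φ ξ η) * (φ ξ η)⁻¹
        = -((φ ξ η)⁻¹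
            * (pd2 (fun ξ η => φ ξ η * Ubar ξ η * (φ ξ η)⁻¹) ξ η
              + ((φ ξ η * Ubar ξ η * (φ ξ η)⁻¹) * M ξ η
                - M ξ η * (φ ξ η * Ubar ξ η * (φ ξ η)⁻¹)))))
      ∧ ((-((φ ξ η)⁻¹ * (pd2 φ ξ η - M ξ η * φ ξ η) * Ubar ξ η * (φ ξ η)⁻¹)
            + Ubar ξ η * (φ ξ η)⁻¹ * (pd2 φ ξ η - M ξ η * φ ξ η) * (φ ξ η)⁻¹ = 0)
        ↔ (pd2 (fun ξ η => φ ξ η * Ubar ξ η * (φ ξ η)⁻¹) ξ η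
            + ((φ ξ η * Ubar ξ η * (φ ξ η)⁻¹) * M ξ η
              - M ξ η * (φ ξ η * Ubar ξ η * (φ ξ η)⁻¹)) = 0)) := by
  intro ξ η
  let _ : NormedAlgebra ℝ (Matrix n n ℂ) := Matrix.linftyOpNormedAlgebra
  have : CompleteSpace (Matrix n n ℂ) := FiniteDimensional.complete ℝ _
  have hline : DifferentiableAt ℝ (fun t : ℝ => ((ξ, t) : ℝ × ℝ)) η := by fun_prop
  have h1 : HasDerivAt (fun t => φ ξ t) (pd2 φ ξ η) η :=
    (DifferentiableAt.comp η (hφ (ξ, η)) hline).hasDerivAt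
  have h2 : HasDerivAt (fun t => Ubar ξ t) 0 η := by
    have h := (DifferentiableAt.comp η (hUbar (ξ, η)) hline).hasDerivAt
    have e := hUbarη ξ η
    unfold pd2 at e
    rw [← e]
    exact h
  obtain ⟨u, hu⟩ := hφinv ξ η
  have hinv : (φ ξ η)⁻¹ = ((u⁻¹ : (Matrix n n ℂ)ˣ) : Matrix n n ℂ) := by
    rw [← hu, Matrix.coe_units_inv]
  have h3 : HasDerivAt (fun t => (φ ξ t)⁻¹)
      (-((φ ξ η)⁻¹ * pd2 φ ξ η * (φ ξ η)⁻¹)) η := by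
    have hf := hasFDerivAt_ringInverse (𝕜 := ℝ) u
    rw [hu] at hf
    have h := hf.comp_hasDerivAt η h1
    have e : (fun t => (φ ξ t)⁻¹) = Ring.inverse ∘ (fun t => φ ξ t) := by
      funext t
      simp [Matrix.nonsing_inv_eq_ringInverse]
    rw [e, hinv]
    simp at h ⊢
    exact h
  have h4 : pd2 (fun ξ η => φ ξ η * Ubar ξ η * (φ ξ η)⁻¹) ξ η
      = pd2 φ ξ η * Ubar ξ η * (φ ξ η)⁻¹
        - φ ξ η * Ubar ξ η * ((φ ξ η)⁻¹ * pd2 φ ξ η * (φ ξ η)⁻¹) := by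
    have h := ((h1.mul h2).mul h3).deriv
    refine Eq.trans h ?_
    simp [sub_eq_add_neg]
  have hl : (φ ξ η)⁻¹ * φ ξ η = 1 := by rw [hinv, ← hu]; simp
  have hr : φ ξ η * (φ ξ η)⁻¹ = 1 := by rw [hinv, ← hu]; simp
  have hl2 : ∀ X, (φ ξ η)⁻¹ * (φ ξ η * X) = X := fun X => by
    rw [← mul_assoc, hl, one_mul]
  have main : -((φ ξ η)⁻¹ * (pd2 φ ξ η - M ξ η * φ ξ η) * Ubar ξ η * (φ ξ η)⁻¹)
          + Ubar ξ η * (φ ξ η)⁻¹ * (pd2 φ ξ η - M ξ η * φ ξ η) * (φ ξ η)⁻¹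
        = -((φ ξ η)⁻¹
            * (pd2 (fun ξ η => φ ξ η * Ubar ξ η * (φ ξ η)⁻¹) ξ η
              + ((φ ξ η * Ubar ξ η * (φ ξ η)⁻¹) * M ξ η
                - M ξ η * (φ ξ η * Ubar ξ η * (φ ξ η)⁻¹)))) := by
    rw [h4]
    simp only [mul_add, mul_sub, sub_mul, mul_assoc, hl2, hr, mul_one]
    abel
  refine ⟨main, ?_⟩
  rw [main, neg_eq_zero]
  constructor
  · intro h
    have h' := congrArg (fun X => φ ξ η * X) h
    simpa only [← mul_assoc, hr, one_mul, mul_zero] using h'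
  · intro h
    rw [h, mul_zero]
end

section
/- Let a₁, …, a_{N₁}, b₁, …, b_{N₂} ∈ ℂ satisfy aᵢ ≠ b_j for all i, j, and let U⁰, V⁰, Uⁱ, Vʲ : ℝ² → Matrix n n ℂ be differentiable. Suppose that for each i, ∂_η Uⁱ + [Uⁱ, V⁰ + Σⱼ Vʲ/(aᵢ − b_j)] = 0, and for each j, ∂_ξ Vʲ + [Vʲ, U⁰ + Σᵢ Uⁱ/(b_j − aᵢ)] = 0. Then Σᵢ (∂_η Uⁱ + [Uⁱ, V⁰]) = Σⱼ (∂_ξ Vʲ + [Vʲ, U⁰]). (The Euler–Lagrange equation obtained by varying g in the ZM Lagrangian is a consequence of the compatibility conditions \eqref{comp2}.) -/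
open Matrix

attribute [local instance] Matrix.linftyOpNormedAddCommGroup Matrix.linftyOpNormedSpace
  Matrix.linftyOpNormedRing

/-- The Euler–Lagrange equation obtained by varying `g` in the ZM Lagrangian
is a consequence of the compatibility conditions (comp2). -/
theorem ZM_g_variation_consequence {n : Type*} [Fintype n] [DecidableEq n]
    {N1 N2 : ℕ} (a : Fin N1 → ℂ) (b : Fin N2 → ℂ)
    (hab : ∀ i j, a i ≠ b j)
    (U0 V0 : ℝ → ℝ → Matrix n n ℂ)
    (U : Fin N1 → ℝ → ℝ → Matrix n n ℂ) (V : Fin N2 → ℝ → ℝ → Matrix n n ℂ)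
    (hU0 : Differentiable ℝ (fun p : ℝ × ℝ => U0 p.1 p.2))
    (hV0 : Differentiable ℝ (fun p : ℝ × ℝ => V0 p.1 p.2))
    (hU : ∀ i, Differentiable ℝ (fun p : ℝ × ℝ => U i p.1 p.2))
    (hV : ∀ j, Differentiable ℝ (fun p : ℝ × ℝ => V j p.1 p.2))
    (hUeq : ∀ i, ∀ ξ η : ℝ, pd2 (U i) ξ η
      + (U i ξ η * (V0 ξ η + ∑ j, (a i - b j)⁻¹ • V j ξ η)
        - (V0 ξ η + ∑ j, (a i - b j)⁻¹ • V j ξ η) * U i ξ η) = 0)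
    (hVeq : ∀ j, ∀ ξ η : ℝ, pd1 (V j) ξ η
      + (V j ξ η * (U0 ξ η + ∑ i, (b j - a i)⁻¹ • U i ξ η)
        - (U0 ξ η + ∑ i, (b j - a i)⁻¹ • U i ξ η) * V j ξ η) = 0) :
    ∀ ξ η : ℝ,
      ∑ i, (pd2 (U i) ξ η + (U i ξ η * V0 ξ η - V0 ξ η * U i ξ η))
        = ∑ j, (pd1 (V j) ξ η + (V j ξ η * U0 ξ η - U0 ξ η * V j ξ η)) := by
  intro ξ η
  have h1 : ∀ i, pd2 (U i) ξ η + (U i ξ η * V0 ξ η - V0 ξ η * U i ξ η)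
      = ∑ j, (a i - b j)⁻¹ • (V j ξ η * U i ξ η - U i ξ η * V j ξ η) := by
    intro i
    have h := hUeq i ξ η
    rw [mul_add, add_mul, Finset.mul_sum, Finset.sum_mul] at h
    simp only [Matrix.mul_smul, Matrix.smul_mul] at h
    simp only [smul_sub, Finset.sum_sub_distrib]
    rw [← sub_eq_zero, ← h]
    abel
  have h2 : ∀ j, pd1 (V j) ξ η + (V j ξ η * U0 ξ η - U0 ξ η * V j ξ η)
      = ∑ i, (a i - b j)⁻¹ • (V j ξ η * U i ξ η - U i ξ η * V j ξ η) := by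
    intro j
    have h := hVeq j ξ η
    have e : ∀ i, (b j - a i)⁻¹ = -(a i - b j)⁻¹ := fun i => by
      rw [← neg_sub, inv_neg]
    rw [mul_add, add_mul, Finset.mul_sum, Finset.sum_mul] at h
    simp only [Matrix.mul_smul, Matrix.smul_mul] at h
    simp only [e, neg_smul, Finset.sum_neg_distrib] at h
    simp only [smul_sub, Finset.sum_sub_distrib]
    rw [← sub_eq_zero, ← h]
    abel
  simp only [h1, h2]
  exact Finset.sum_comm
end

section
/- Let a₁,…,a_{N₁}, b₁,…,b_{N₂}, c₁,…,c_{N₃} ∈ ℂ be pairwise distinct. Let φⁱ, ψʲ, χᵏ : ℝ³ → Matrix n n ℂ be smooth and invertible at every point of (ξ, η, ν)-space, and let Ūⁱ, V̄ʲ, W̄ᵏ : ℝ³ → Matrix n n ℂ be smooth with ∂_η Ūⁱ = ∂_ν Ūⁱ = 0, ∂_ξ V̄ʲ = ∂_ν V̄ʲ = 0, ∂_ξ W̄ᵏ = ∂_η W̄ᵏ = 0. Define Uⁱ := φⁱ Ūⁱ (φⁱ)⁻¹, Vʲ := ψʲ V̄ʲ (ψʲ)⁻¹, Wᵏ := χᵏ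 W̄ᵏ (χᵏ)⁻¹, and for μ not a pole put U(μ) := Σᵢ Uⁱ/(μ − aᵢ), V(μ) := Σⱼ Vʲ/(μ − b_j), W(μ) := Σₖ Wᵏ/(μ − cₖ). Assume the linear equations ∂_η φⁱ = V(aᵢ) φⁱ, ∂_ν φⁱ = W(aᵢ) φⁱ, ∂_ξ ψʲ = U(b_j) ψʲ, ∂_ν ψʲ = W(b_j) ψʲ, ∂_ξ χᵏ = U(cₖ) χᵏ, ∂_η χᵏ = V(cₖ) χᵏ hold on ℝ³. Define the scalar functions L_{ξη} := tr{ Σᵢ (φⁱ)⁻¹ (∂_η φⁱ) Ūⁱ − Σⱼ (ψʲ)⁻¹ (∂_ξ ψʲ) V̄ʲ − Σ_{i,j} Vʲ Uⁱ/(aᵢ − b_j) }, L_{ην} := tr{ Σⱼ (ψʲ)⁻¹ (∂_ν ψʲ) V̄ʲ − Σₖ (χᵏ)⁻¹ (∂_η χᵏ) W̄ᵏ − Σ_{j,k} Wᵏ Vʲ/(b_j − cₖ) }, and L_{νξ} := tr{ Σₖ (χᵏ)⁻¹ (∂_ξ χᵏ) W̄ᵏ − Σᵢ (φⁱ)⁻¹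 (∂_ν φⁱ) Ūⁱ − Σ_{k,i} Uⁱ Wᵏ/(cₖ − aᵢ) }. Then ∂_ν L_{ξη} + ∂_ξ L_{ην} + ∂_η L_{νξ} = 0 on all of ℝ³. (Closure of the Zakharov–Mikhailov Lagrangian 2-form on solutions.) -/
open Matrix

attribute [local instance] Matrix.linftyOpNormedAddCommGroup Matrix.linftyOpNormedSpace
  Matrix.linftyOpNormedRing

section helpers

attribute [local instance] Matrix.linftyOpNormedAlgebra

theorem ZM_hasDerivAt_conj {n : Type*} [Fintype n] [DecidableEq n]
    (g u U : ℝ → Matrix n n ℂ) (A : Matrix n n ℂ) (t : ℝ)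
    (hg : DifferentiableAt ℝ g t) (hu : DifferentiableAt ℝ u t)
    (hg' : deriv g t = A * g t) (hu' : deriv u t = 0)
    (hinv : IsUnit (g t)) (hU : ∀ s, U s = g s * u s * (g s)⁻¹) :
    HasDerivAt U (A * U t - U t * A) t := by
  obtain rfl : U = fun s => g s * u s * (g s)⁻¹ := funext hU
  have h1 : HasDerivAt g (A * g t) t := hg' ▸ hg.hasDerivAt
  have h2 : HasDerivAt u 0 t := hu' ▸ hu.hasDerivAt
  obtain ⟨x, hx⟩ := hinv
  have h3 : HasDerivAt (fun s => (g s)⁻¹) (-((g t)⁻¹ * (A * g t) * (g t)⁻¹)) t := by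
    have h := hasFDerivAt_ringInverse (𝕜 := ℝ) x
    rw [hx] at h
    have h4 := h.comp_hasDerivAt t h1
    have e : (fun s => (g s)⁻¹) = Ring.inverse ∘ g := by
      funext s
      simp [Matrix.nonsing_inv_eq_ringInverse]
    rw [e]
    refine h4.congr_deriv ?_
    simp [← hx, Matrix.coe_units_inv]
  have hd : IsUnit (g t).det := (Matrix.isUnit_iff_isUnit_det _).1 ⟨x, hx⟩
  refine ((h1.mul h2).mul h3).congr_deriv ?_
  have e1 : g t * (g t)⁻¹ = 1 := Matrix.mul_nonsing_inv _ hd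
  change (A * g t * u t + g t * 0) * (g t)⁻¹ + g t * u t * (-((g t)⁻¹ * (A * g t) * (g t)⁻¹)) = _
  simp only [mul_zero, add_zero, mul_neg, Matrix.mul_assoc, e1, mul_one, sub_eq_add_neg]

theorem ZM_hasDerivAt_block {n : Type*} [Fintype n] [DecidableEq n] {N1 N2 N3 : ℕ}
    (a : Fin N1 → ℂ) (b : Fin N2 → ℂ) (c : Fin N3 → ℂ)
    (hab : ∀ i j, a i ≠ b j) (hbc : ∀ j k, b j ≠ c k) (hca : ∀ k i, c k ≠ a i)
    (u : Fin N1 → ℝ → Matrix n n ℂ) (v : Fin N2 → ℝ → Matrix n n ℂ)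
    (w : Fin N3 → Matrix n n ℂ) (t : ℝ)
    (hu : ∀ i, HasDerivAt (u i) ((∑ k, (a i - c k)⁻¹ • w k) * u i t
      - u i t * (∑ k, (a i - c k)⁻¹ • w k)) t)
    (hv : ∀ j, HasDerivAt (v j) ((∑ k, (b j - c k)⁻¹ • w k) * v j t
      - v j t * (∑ k, (b j - c k)⁻¹ • w k)) t) :
    HasDerivAt (fun s => ∑ i, ∑ j, (a i - b j)⁻¹ * Matrix.trace (v j s * u i s))
      (∑ i, ∑ j, ∑ k, ((b j - c k)⁻¹ * (a i - c k)⁻¹) *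
        (Matrix.trace (w k * v j t * u i t) - Matrix.trace (w k * u i t * v j t))) t := by
  refine HasDerivAt.fun_sum fun i _ => HasDerivAt.fun_sum fun j _ => ?_
  have h := (hv j).mul (hu i)
  have h2 : HasDerivAt (fun s => Matrix.trace (v j s * u i s))
      (Matrix.trace (((∑ k, (b j - c k)⁻¹ • w k) * v j t
      - v j t * (∑ k, (b j - c k)⁻¹ • w k)) * u i t + v j t * ((∑ k, (a i - c k)⁻¹ • w k) * u i t
      - u i t * (∑ k, (a i - c k)⁻¹ • w k)))) t :=
    HasFDerivAt.comp_hasDerivAt (l := fun M : Matrix n n ℂ => Matrix.trace M)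
      (l' := (Matrix.traceLinearMap n ℝ ℂ).toContinuousLinearMap) t
      ((Matrix.traceLinearMap n ℝ ℂ).toContinuousLinearMap.hasFDerivAt) h
  refine (h2.const_mul ((a i - b j)⁻¹)).congr_deriv ?_
  have e : ∀ k, Matrix.trace (v j t * w k * u i t) = Matrix.trace (w k * u i t * v j t) := by
    intro k
    rw [Matrix.trace_mul_cycle, Matrix.trace_mul_cycle]
  have e' : ∀ k, Matrix.trace (v j t * u i t * w k) = Matrix.trace (w k * v j t * u i t) := by
    intro k
    rw [Matrix.trace_mul_cycle]
  simp only [Finset.sum_mul,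
    Finset.mul_sum, sub_mul, mul_sub, Matrix.trace_add, Matrix.trace_sub, Matrix.trace_sum,
    Matrix.smul_mul, Matrix.mul_smul, Matrix.trace_smul, ← Matrix.mul_assoc, e, e', smul_eq_mul]
  simp only [mul_add, mul_sub, Finset.mul_sum, ← Finset.sum_sub_distrib, ← Finset.sum_add_distrib]
  refine Finset.sum_congr rfl fun k _ => ?_
  have h1 := sub_ne_zero.2 (hab i j)
  have h2 := sub_ne_zero.2 (hbc j k)
  have h3 := sub_ne_zero.2 (hca k i).symm
  field_simp
  ring

theorem ZM_lagr_eq {n : Type*} [Fintype n] [DecidableEq n] {N1 N2 : ℕ}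
    (a : Fin N1 → ℂ) (b : Fin N2 → ℂ)
    (φ dφ ub u : Fin N1 → Matrix n n ℂ) (ψ dψ vb v : Fin N2 → Matrix n n ℂ)
    (hφ : ∀ i, dφ i = (∑ j, (a i - b j)⁻¹ • v j) * φ i)
    (hψ : ∀ j, dψ j = (∑ i, (b j - a i)⁻¹ • u i) * ψ j)
    (hu : ∀ i, u i = φ i * ub i * (φ i)⁻¹) (hv : ∀ j, v j = ψ j * vb j * (ψ j)⁻¹) :
    Matrix.trace (∑ i, (φ i)⁻¹ * dφ i * ub i - ∑ j, (ψ j)⁻¹ * dψ j * vb j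
      - ∑ i, ∑ j, (a i - b j)⁻¹ • (v j * u i))
      = ∑ i, ∑ j, (a i - b j)⁻¹ * Matrix.trace (v j * u i) := by
  have key : ∀ g X y : Matrix n n ℂ, Matrix.trace (g⁻¹ * (X * g) * y)
      = Matrix.trace (X * (g * y * g⁻¹)) := by
    intro g X y
    rw [Matrix.mul_assoc, Matrix.trace_mul_comm]
    simp only [Matrix.mul_assoc]
  have h1 : ∀ i, Matrix.trace ((φ i)⁻¹ * dφ i * ub i)
      = ∑ j, (a i - b j)⁻¹ * Matrix.trace (v j * u i) := by
    intro i
    rw [hφ, key, ← hu, Finset.sum_mul, Matrix.trace_sum]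
    simp
  have h2 : ∀ j, Matrix.trace ((ψ j)⁻¹ * dψ j * vb j)
      = ∑ i, -((a i - b j)⁻¹ * Matrix.trace (v j * u i)) := by
    intro j
    rw [hψ, key, ← hv, Finset.sum_mul, Matrix.trace_sum]
    refine Finset.sum_congr rfl fun i _ => ?_
    rw [Matrix.smul_mul, Matrix.trace_smul, smul_eq_mul, Matrix.trace_mul_comm, ← neg_sub (a i),
      inv_neg, neg_mul]
  simp only [Matrix.trace_sub, Matrix.trace_sum, h1, h2, Matrix.trace_smul, smul_eq_mul]
  rw [Finset.sum_comm (s := (Finset.univ : Finset (Fin N2)))]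
  simp only [Finset.sum_neg_distrib]
  ring

theorem Smooth3.dx {E : Type*} [NormedAddCommGroup E] [NormedSpace ℝ E]
    {f : ℝ → ℝ → ℝ → E} (h : Smooth3 f) (x y z : ℝ) :
    DifferentiableAt ℝ (fun t => f t y z) x := by
  have h1 : Differentiable ℝ (fun p : ℝ × ℝ × ℝ => f p.1 p.2.1 p.2.2) :=
    ContDiff.differentiable h (by simp)
  exact (h1 (x, y, z)).comp x (f := fun t : ℝ => ((t, y, z) : ℝ × ℝ × ℝ)) (by fun_prop)

theorem Smooth3.dy {E : Type*} [NormedAddCommGroup E] [NormedSpace ℝ E]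
    {f : ℝ → ℝ → ℝ → E} (h : Smooth3 f) (x y z : ℝ) :
    DifferentiableAt ℝ (fun t => f x t z) y := by
  have h1 : Differentiable ℝ (fun p : ℝ × ℝ × ℝ => f p.1 p.2.1 p.2.2) :=
    ContDiff.differentiable h (by simp)
  exact (h1 (x, y, z)).comp y (f := fun t : ℝ => ((x, t, z) : ℝ × ℝ × ℝ)) (by fun_prop)

theorem Smooth3.dz {E : Type*} [NormedAddCommGroup E] [NormedSpace ℝ E]
    {f : ℝ → ℝ → ℝ → E} (h : Smooth3 f) (x y z : ℝ) :
    DifferentiableAt ℝ (fun t => f x y t) z := by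
  have h1 : Differentiable ℝ (fun p : ℝ × ℝ × ℝ => f p.1 p.2.1 p.2.2) :=
    ContDiff.differentiable h (by simp)
  exact (h1 (x, y, z)).comp z (f := fun t : ℝ => ((x, y, t) : ℝ × ℝ × ℝ)) (by fun_prop)

end helpers

/-- Closure of the Zakharov–Mikhailov Lagrangian 2-form on solutions:
`∂_ν L_{ξη} + ∂_ξ L_{ην} + ∂_η L_{νξ} = 0`. -/
theorem ZM_multiform_closure {n : Type*} [Fintype n] [DecidableEq n]
    {N1 N2 N3 : ℕ} (a : Fin N1 → ℂ) (b : Fin N2 → ℂ) (c : Fin N3 → ℂ)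
    (ha : Function.Injective a) (hb : Function.Injective b)
    (hc : Function.Injective c)
    (hab : ∀ i j, a i ≠ b j) (hbc : ∀ j k, b j ≠ c k) (hca : ∀ k i, c k ≠ a i)
    (φ : Fin N1 → ℝ → ℝ → ℝ → Matrix n n ℂ)
    (ψ : Fin N2 → ℝ → ℝ → ℝ → Matrix n n ℂ)
    (χ : Fin N3 → ℝ → ℝ → ℝ → Matrix n n ℂ)
    (Ubar : Fin N1 → ℝ → ℝ → ℝ → Matrix n n ℂ)
    (Vbar : Fin N2 → ℝ → ℝ → ℝ → Matrix n n ℂ)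
    (Wbar : Fin N3 → ℝ → ℝ → ℝ → Matrix n n ℂ)
    (hφ : ∀ i, Smooth3 (φ i)) (hψ : ∀ j, Smooth3 (ψ j)) (hχ : ∀ k, Smooth3 (χ k))
    (hφinv : ∀ i ξ η ν, IsUnit (φ i ξ η ν))
    (hψinv : ∀ j ξ η ν, IsUnit (ψ j ξ η ν))
    (hχinv : ∀ k ξ η ν, IsUnit (χ k ξ η ν))
    (hUbar : ∀ i, Smooth3 (Ubar i)) (hVbar : ∀ j, Smooth3 (Vbar j))
    (hWbar : ∀ k, Smooth3 (Wbar k))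
    (hUbarη : ∀ i ξ η ν, pdy (Ubar i) ξ η ν = 0)
    (hUbarν : ∀ i ξ η ν, pdz (Ubar i) ξ η ν = 0)
    (hVbarξ : ∀ j ξ η ν, pdx (Vbar j) ξ η ν = 0)
    (hVbarν : ∀ j ξ η ν, pdz (Vbar j) ξ η ν = 0)
    (hWbarξ : ∀ k ξ η ν, pdx (Wbar k) ξ η ν = 0)
    (hWbarη : ∀ k ξ η ν, pdy (Wbar k) ξ η ν = 0)
    (U : Fin N1 → ℝ → ℝ → ℝ → Matrix n n ℂ)
    (V : Fin N2 → ℝ → ℝ → ℝ → Matrix n n ℂ)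
    (W : Fin N3 → ℝ → ℝ → ℝ → Matrix n n ℂ)
    (hU : ∀ i ξ η ν, U i ξ η ν = φ i ξ η ν * Ubar i ξ η ν * (φ i ξ η ν)⁻¹)
    (hV : ∀ j ξ η ν, V j ξ η ν = ψ j ξ η ν * Vbar j ξ η ν * (ψ j ξ η ν)⁻¹)
    (hW : ∀ k ξ η ν, W k ξ η ν = χ k ξ η ν * Wbar k ξ η ν * (χ k ξ η ν)⁻¹)
    (hφη : ∀ i ξ η ν, pdy (φ i) ξ η ν
      = (∑ j, (a i - b j)⁻¹ • V j ξ η ν) * φ i ξ η ν)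
    (hφν : ∀ i ξ η ν, pdz (φ i) ξ η ν
      = (∑ k, (a i - c k)⁻¹ • W k ξ η ν) * φ i ξ η ν)
    (hψξ : ∀ j ξ η ν, pdx (ψ j) ξ η ν
      = (∑ i, (b j - a i)⁻¹ • U i ξ η ν) * ψ j ξ η ν)
    (hψν : ∀ j ξ η ν, pdz (ψ j) ξ η ν
      = (∑ k, (b j - c k)⁻¹ • W k ξ η ν) * ψ j ξ η ν)
    (hχξ : ∀ k ξ η ν, pdx (χ k) ξ η ν
      = (∑ i, (c k - a i)⁻¹ • U i ξ η ν) * χ k ξ η ν)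
    (hχη : ∀ k ξ η ν, pdy (χ k) ξ η ν
      = (∑ j, (c k - b j)⁻¹ • V j ξ η ν) * χ k ξ η ν)
    (L12 L23 L31 : ℝ → ℝ → ℝ → ℂ)
    (hL12 : ∀ ξ η ν, L12 ξ η ν = Matrix.trace
      (∑ i, (φ i ξ η ν)⁻¹ * pdy (φ i) ξ η ν * Ubar i ξ η ν
        - ∑ j, (ψ j ξ η ν)⁻¹ * pdx (ψ j) ξ η ν * Vbar j ξ η ν
        - ∑ i, ∑ j, (a i - b j)⁻¹ • (V j ξ η ν * U i ξ η ν)))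
    (hL23 : ∀ ξ η ν, L23 ξ η ν = Matrix.trace
      (∑ j, (ψ j ξ η ν)⁻¹ * pdz (ψ j) ξ η ν * Vbar j ξ η ν
        - ∑ k, (χ k ξ η ν)⁻¹ * pdy (χ k) ξ η ν * Wbar k ξ η ν
        - ∑ j, ∑ k, (b j - c k)⁻¹ • (W k ξ η ν * V j ξ η ν)))
    (hL31 : ∀ ξ η ν, L31 ξ η ν = Matrix.trace
      (∑ k, (χ k ξ η ν)⁻¹ * pdx (χ k) ξ η ν * Wbar k ξ η ν
        - ∑ i, (φ i ξ η ν)⁻¹ * pdz (φ i) ξ η ν * Ubar i ξ η ν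
        - ∑ k, ∑ i, (c k - a i)⁻¹ • (U i ξ η ν * W k ξ η ν))) :
    ∀ ξ η ν, pdz L12 ξ η ν + pdx L23 ξ η ν + pdy L31 ξ η ν = 0 := by
  intro ξ η ν
  have hac : ∀ i k, a i ≠ c k := fun i k => (hca k i).symm
  have hba : ∀ j i, b j ≠ a i := fun j i => (hab i j).symm
  have hcb : ∀ k j, c k ≠ b j := fun k j => (hbc j k).symm
  have L1 : ∀ ξ η ν, L12 ξ η ν
      = ∑ i, ∑ j, (a i - b j)⁻¹ * Matrix.trace (V j ξ η ν * U i ξ η ν) := fun ξ η ν => by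
    rw [hL12]
    exact ZM_lagr_eq a b _ _ _ (fun i => U i ξ η ν) _ _ _ (fun j => V j ξ η ν)
      (fun i => hφη i ξ η ν) (fun j => hψξ j ξ η ν) (fun i => hU i ξ η ν) (fun j => hV j ξ η ν)
  have L2 : ∀ ξ η ν, L23 ξ η ν
      = ∑ j, ∑ k, (b j - c k)⁻¹ * Matrix.trace (W k ξ η ν * V j ξ η ν) := fun ξ η ν => by
    rw [hL23]
    exact ZM_lagr_eq b c _ _ _ (fun i => V i ξ η ν) _ _ _ (fun j => W j ξ η ν)
      (fun i => hψν i ξ η ν) (fun j => hχη j ξ η ν) (fun i => hV i ξ η ν) (fun j => hW j ξ η ν)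
  have L3 : ∀ ξ η ν, L31 ξ η ν
      = ∑ k, ∑ i, (c k - a i)⁻¹ * Matrix.trace (U i ξ η ν * W k ξ η ν) := fun ξ η ν => by
    rw [hL31]
    exact ZM_lagr_eq c a _ _ _ (fun i => W i ξ η ν) _ _ _ (fun j => U j ξ η ν)
      (fun i => hχξ i ξ η ν) (fun j => hφν j ξ η ν) (fun i => hW i ξ η ν) (fun j => hU j ξ η ν)
  have D1 := ZM_hasDerivAt_block a b c hab hbc hca (fun i t => U i ξ η t) (fun j t => V j ξ η t)
    (fun k => W k ξ η ν) ν
    (fun i => ZM_hasDerivAt_conj _ _ _ _ ν ((hφ i).dz ξ η ν) ((hUbar i).dz ξ η ν)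
      (hφν i ξ η ν) (hUbarν i ξ η ν) (hφinv i ξ η ν) (fun s => hU i ξ η s))
    (fun j => ZM_hasDerivAt_conj _ _ _ _ ν ((hψ j).dz ξ η ν) ((hVbar j).dz ξ η ν)
      (hψν j ξ η ν) (hVbarν j ξ η ν) (hψinv j ξ η ν) (fun s => hV j ξ η s))
  have D2 := ZM_hasDerivAt_block b c a hbc hca hab (fun j t => V j t η ν) (fun k t => W k t η ν)
    (fun i => U i ξ η ν) ξ
    (fun j => ZM_hasDerivAt_conj _ _ _ _ ξ ((hψ j).dx ξ η ν) ((hVbar j).dx ξ η ν)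
      (hψξ j ξ η ν) (hVbarξ j ξ η ν) (hψinv j ξ η ν) (fun s => hV j s η ν))
    (fun k => ZM_hasDerivAt_conj _ _ _ _ ξ ((hχ k).dx ξ η ν) ((hWbar k).dx ξ η ν)
      (hχξ k ξ η ν) (hWbarξ k ξ η ν) (hχinv k ξ η ν) (fun s => hW k s η ν))
  have D3 := ZM_hasDerivAt_block c a b hca hab hbc (fun k t => W k ξ t ν) (fun i t => U i ξ t ν)
    (fun j => V j ξ η ν) η
    (fun k => ZM_hasDerivAt_conj _ _ _ _ η ((hχ k).dy ξ η ν) ((hWbar k).dy ξ η ν)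
      (hχη k ξ η ν) (hWbarη k ξ η ν) (hχinv k ξ η ν) (fun s => hW k ξ s ν))
    (fun i => ZM_hasDerivAt_conj _ _ _ _ η ((hφ i).dy ξ η ν) ((hUbar i).dy ξ η ν)
      (hφη i ξ η ν) (hUbarη i ξ η ν) (hφinv i ξ η ν) (fun s => hU i ξ s ν))
  simp only [pdx, pdy, pdz, L1, L2, L3]
  rw [D1.deriv, D2.deriv, D3.deriv]
  have c2 : ∀ f : Fin N2 → Fin N3 → Fin N1 → ℂ,
      ∑ j, ∑ k, ∑ i, f j k i = ∑ i, ∑ j, ∑ k, f j k i := by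
    intro f
    rw [Finset.sum_comm (s := (Finset.univ : Finset (Fin N1)))]
    exact Finset.sum_congr rfl fun j _ => Finset.sum_comm
  have c3 : ∀ f : Fin N3 → Fin N1 → Fin N2 → ℂ,
      ∑ k, ∑ i, ∑ j, f k i j = ∑ i, ∑ j, ∑ k, f k i j := by
    intro f
    rw [Finset.sum_comm]
    exact Finset.sum_congr rfl fun i _ => Finset.sum_comm
  rw [c2, c3]
  simp only [← Finset.sum_add_distrib]
  refine Finset.sum_eq_zero fun i _ => Finset.sum_eq_zero fun j _ => Finset.sum_eq_zero fun k _ => ?_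
  have t1 : Matrix.trace (U i ξ η ν * W k ξ η ν * V j ξ η ν)
      = Matrix.trace (W k ξ η ν * V j ξ η ν * U i ξ η ν) := by
    rw [Matrix.trace_mul_cycle, Matrix.trace_mul_cycle]
  have t2 : Matrix.trace (U i ξ η ν * V j ξ η ν * W k ξ η ν)
      = Matrix.trace (W k ξ η ν * U i ξ η ν * V j ξ η ν) := Matrix.trace_mul_cycle _ _ _
  have t3 : Matrix.trace (V j ξ η ν * U i ξ η ν * W k ξ η ν)
      = Matrix.trace (W k ξ η ν * V j ξ η ν * U i ξ η ν) := Matrix.trace_mul_cycle _ _ _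
  have t4 : Matrix.trace (V j ξ η ν * W k ξ η ν * U i ξ η ν)
      = Matrix.trace (W k ξ η ν * U i ξ η ν * V j ξ η ν) := by
    rw [Matrix.trace_mul_cycle, Matrix.trace_mul_cycle]
  rw [t1, t2, t3, t4]
  have n1 := sub_ne_zero.2 (hab i j)
  have n2 := sub_ne_zero.2 (hbc j k)
  have n3 := sub_ne_zero.2 (hca k i)
  rw [← neg_sub (c k) (a i), ← neg_sub (a i) (b j), ← neg_sub (b j) (c k)]
  field_simp
  ring
end

section
/- Let q, r : ℝ³ → ℂ be smooth functions of (x₁, x₂, x₃) satisfying on all of ℝ³ the second AKNS flow ∂_{x₂}q = (i/2)q_{x₁x₁} − i q² r, ∂_{x₂}r = −(i/2)r_{x₁x₁} + i r² q, and the third AKNS flow ∂_{x₃}q = (3/2)q r q_{x₁} − (1/4)q_{x₁x₁x₁}, ∂_{x₃}r = (3/2)r q r_{x₁} − (1/4)r_{x₁x₁x₁}. Define the scalar functions on ℝ³: L₁₂ := (1/2)(r q_{x₂} − q r_{x₂}) + (i/2)q_{x₁}r_{x₁} + (i/2)q²r²; L₃₁ := (1/2)(q r_{x₃} − r q_{x₃})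 + (1/8)(r_{x₁}q_{x₁x₁} − q_{x₁}r_{x₁x₁}) + (3/8)q r (r q_{x₁} − q r_{x₁}); L₂₃ := (1/4)(q_{x₂}r_{x₁x₁} − r_{x₂}q_{x₁x₁}) − (i/2)(q_{x₃}r_{x₁} + r_{x₃}q_{x₁}) + (1/8)(q_{x₁}r_{x₁x₂} − r_{x₁}q_{x₁x₂}) + (3/8)q r (q r_{x₂} − r q_{x₂}) − (i/8)q_{x₁x₁}r_{x₁x₁} + (i/4)q r (q r_{x₁x₁} + r q_{x₁x₁}) − (i/8)(q²(r_{x₁})² + r²(q_{x₁})²) + (i/4)q r q_{x₁} r_{x₁} − (i/2)q³r³. Then ∂_{x₃}L₁₂ + ∂_{x₁}L₂₃ + ∂_{x₂}L₃₁ = 0 on all of ℝ³. (Closure of the scalar AKNS Lagrangian 2-form on solutions of the hierarchy.) -/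
open Complex

namespace AKNSaux

/-- Uncurried function. -/
def unc (f : ℝ → ℝ → ℝ → ℂ) : ℝ × ℝ × ℝ → ℂ := fun p => f p.1 p.2.1 p.2.2

/-- Directional derivative. -/
noncomputable def dd (v : ℝ × ℝ × ℝ) (f : ℝ → ℝ → ℝ → ℂ) : ℝ → ℝ → ℝ → ℂ :=
  fun x y z => fderiv ℝ (unc f) (x, y, z) v

/-- Constant function. -/
def K (c : ℂ) : ℝ → ℝ → ℝ → ℂ := fun _ _ _ => c

lemma sm {f : ℝ → ℝ → ℝ → ℂ} (h : Smooth3 f) : ContDiff ℝ (⊤ : ℕ∞) (unc f) := h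

lemma df {f : ℝ → ℝ → ℝ → ℂ} (h : Smooth3 f) : Differentiable ℝ (unc f) :=
  (sm h).differentiable (by simp)

lemma pdx_eq {f : ℝ → ℝ → ℝ → ℂ} (h : Smooth3 f) : pdx f = dd (1, 0, 0) f := by
  funext x y z
  have h1 : HasDerivAt (fun t : ℝ => (t, y, z)) ((1 : ℝ), (0 : ℝ), (0 : ℝ)) x :=
    (hasDerivAt_id x).prodMk ((hasDerivAt_const x y).prodMk (hasDerivAt_const x z))
  exact ((df h (x, y, z)).hasFDerivAt.comp_hasDerivAt x h1).deriv

lemma pdy_eq {f : ℝ → ℝ → ℝ → ℂ} (h : Smooth3 f) : pdy f = dd (0, 1, 0) f := by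
  funext x y z
  have h1 : HasDerivAt (fun t : ℝ => (x, t, z)) ((0 : ℝ), (1 : ℝ), (0 : ℝ)) y :=
    (hasDerivAt_const y x).prodMk ((hasDerivAt_id y).prodMk (hasDerivAt_const y z))
  exact ((df h (x, y, z)).hasFDerivAt.comp_hasDerivAt y h1).deriv

lemma pdz_eq {f : ℝ → ℝ → ℝ → ℂ} (h : Smooth3 f) : pdz f = dd (0, 0, 1) f := by
  funext x y z
  have h1 : HasDerivAt (fun t : ℝ => (x, y, t)) ((0 : ℝ), (0 : ℝ), (1 : ℝ)) z :=
    (hasDerivAt_const z x).prodMk ((hasDerivAt_const z y).prodMk (hasDerivAt_id z))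
  exact ((df h (x, y, z)).hasFDerivAt.comp_hasDerivAt z h1).deriv

lemma sm_dd (v : ℝ × ℝ × ℝ) {f : ℝ → ℝ → ℝ → ℂ} (h : Smooth3 f) : Smooth3 (dd v f) := by
  have : ContDiff ℝ (⊤ : ℕ∞) (fun p => fderiv ℝ (unc f) p v) :=
    ((sm h).fderiv_right (m := (⊤ : ℕ∞)) (by simp)).clm_apply contDiff_const
  exact this

lemma sm_K (c : ℂ) : Smooth3 (K c) := contDiff_const

lemma sm_add {f g : ℝ → ℝ → ℝ → ℂ} (hf : Smooth3 f) (hg : Smooth3 g) : Smooth3 (f + g) :=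
  ContDiff.add hf hg

lemma sm_sub {f g : ℝ → ℝ → ℝ → ℂ} (hf : Smooth3 f) (hg : Smooth3 g) : Smooth3 (f - g) :=
  ContDiff.sub hf hg

lemma sm_mul {f g : ℝ → ℝ → ℝ → ℂ} (hf : Smooth3 f) (hg : Smooth3 g) : Smooth3 (f * g) :=
  ContDiff.mul hf hg

lemma dd_K (v : ℝ × ℝ × ℝ) (c : ℂ) : dd v (K c) = 0 := by
  funext x y z
  have : unc (K c) = fun _ => c := rfl
  simp [dd, this]

lemma dd_add (v : ℝ × ℝ × ℝ) {f g : ℝ → ℝ → ℝ → ℂ} (hf : Smooth3 f) (hg : Smooth3 g) :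
    dd v (f + g) = dd v f + dd v g := by
  funext x y z
  have : unc (f + g) = unc f + unc g := rfl
  simp [dd, this, fderiv_add (df hf _) (df hg _)]

lemma dd_sub (v : ℝ × ℝ × ℝ) {f g : ℝ → ℝ → ℝ → ℂ} (hf : Smooth3 f) (hg : Smooth3 g) :
    dd v (f - g) = dd v f - dd v g := by
  funext x y z
  have : unc (f - g) = unc f - unc g := rfl
  simp [dd, this, fderiv_sub (df hf _) (df hg _)]

lemma dd_mul (v : ℝ × ℝ × ℝ) {f g : ℝ → ℝ → ℝ → ℂ} (hf : Smooth3 f) (hg : Smooth3 g) :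
    dd v (f * g) = f * dd v g + dd v f * g := by
  funext x y z
  have : unc (f * g) = unc f * unc g := rfl
  simp [dd, this, fderiv_mul (df hf _) (df hg _), unc]
  ring

lemma dd_comm (v w : ℝ × ℝ × ℝ) {f : ℝ → ℝ → ℝ → ℂ} (h : Smooth3 f) :
    dd v (dd w f) = dd w (dd v f) := by
  have key : ∀ v w : ℝ × ℝ × ℝ, ∀ x y z, dd v (dd w f) x y z
      = fderiv ℝ (fderiv ℝ (unc f)) (x, y, z) v w := by
    intro v w x y z
    have hd : DifferentiableAt ℝ (fderiv ℝ (unc f)) (x, y, z) :=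
      ((sm h).fderiv_right (m := (⊤ : ℕ∞)) (by simp)).differentiable (by simp) _
    have e : unc (dd w f) = fun p => fderiv ℝ (unc f) p w := rfl
    simp only [dd] at e ⊢
    rw [e, fderiv_clm_apply hd (differentiableAt_const w)]
    simp
  funext x y z
  rw [key, key]
  have hs : IsSymmSndFDerivAt ℝ (unc f) (x, y, z) :=
    (sm h).contDiffAt.isSymmSndFDerivAt (by
      simp only [minSmoothness_of_isRCLikeNormedField]; exact WithTop.coe_le_coe.2 (le_top : (2 : ℕ∞) ≤ ⊤))
  exact hs v w

end AKNSaux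

open AKNSaux

/-- Closure of the scalar AKNS Lagrangian 2-form on solutions of the hierarchy:
`∂_{x₃}L₁₂ + ∂_{x₁}L₂₃ + ∂_{x₂}L₃₁ = 0`. -/
theorem AKNS_multiform_closure (q r : ℝ → ℝ → ℝ → ℂ)
    (hq : Smooth3 q) (hr : Smooth3 r)
    (hq2 : ∀ x1 x2 x3, pdy q x1 x2 x3
      = (I / 2) * pdx (pdx q) x1 x2 x3 - I * (q x1 x2 x3) ^ 2 * r x1 x2 x3)
    (hr2 : ∀ x1 x2 x3, pdy r x1 x2 x3
      = -(I / 2) * pdx (pdx r) x1 x2 x3 + I * (r x1 x2 x3) ^ 2 * q x1 x2 x3)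
    (hq3 : ∀ x1 x2 x3, pdz q x1 x2 x3
      = (3 / 2 : ℂ) * q x1 x2 x3 * r x1 x2 x3 * pdx q x1 x2 x3
        - (1 / 4 : ℂ) * pdx (pdx (pdx q)) x1 x2 x3)
    (hr3 : ∀ x1 x2 x3, pdz r x1 x2 x3
      = (3 / 2 : ℂ) * r x1 x2 x3 * q x1 x2 x3 * pdx r x1 x2 x3
        - (1 / 4 : ℂ) * pdx (pdx (pdx r)) x1 x2 x3)
    (L12 L23 L31 : ℝ → ℝ → ℝ → ℂ)
    (hL12 : ∀ x1 x2 x3, L12 x1 x2 x3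
      = (1 / 2 : ℂ) * (r x1 x2 x3 * pdy q x1 x2 x3 - q x1 x2 x3 * pdy r x1 x2 x3)
        + (I / 2) * pdx q x1 x2 x3 * pdx r x1 x2 x3
        + (I / 2) * (q x1 x2 x3) ^ 2 * (r x1 x2 x3) ^ 2)
    (hL31 : ∀ x1 x2 x3, L31 x1 x2 x3
      = (1 / 2 : ℂ) * (q x1 x2 x3 * pdz r x1 x2 x3 - r x1 x2 x3 * pdz q x1 x2 x3)
        + (1 / 8 : ℂ) * (pdx r x1 x2 x3 * pdx (pdx q) x1 x2 x3
          - pdx q x1 x2 x3 * pdx (pdx r) x1 x2 x3)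
        + (3 / 8 : ℂ) * q x1 x2 x3 * r x1 x2 x3
          * (r x1 x2 x3 * pdx q x1 x2 x3 - q x1 x2 x3 * pdx r x1 x2 x3))
    (hL23 : ∀ x1 x2 x3, L23 x1 x2 x3
      = (1 / 4 : ℂ) * (pdy q x1 x2 x3 * pdx (pdx r) x1 x2 x3
          - pdy r x1 x2 x3 * pdx (pdx q) x1 x2 x3)
        - (I / 2) * (pdz q x1 x2 x3 * pdx r x1 x2 x3
          + pdz r x1 x2 x3 * pdx q x1 x2 x3)
        + (1 / 8 : ℂ) * (pdx q x1 x2 x3 * pdx (pdy r) x1 x2 x3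
          - pdx r x1 x2 x3 * pdx (pdy q) x1 x2 x3)
        + (3 / 8 : ℂ) * q x1 x2 x3 * r x1 x2 x3
          * (q x1 x2 x3 * pdy r x1 x2 x3 - r x1 x2 x3 * pdy q x1 x2 x3)
        - (I / 8) * pdx (pdx q) x1 x2 x3 * pdx (pdx r) x1 x2 x3
        + (I / 4) * q x1 x2 x3 * r x1 x2 x3
          * (q x1 x2 x3 * pdx (pdx r) x1 x2 x3 + r x1 x2 x3 * pdx (pdx q) x1 x2 x3)
        - (I / 8) * ((q x1 x2 x3) ^ 2 * (pdx r x1 x2 x3) ^ 2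
          + (r x1 x2 x3) ^ 2 * (pdx q x1 x2 x3) ^ 2)
        + (I / 4) * q x1 x2 x3 * r x1 x2 x3 * pdx q x1 x2 x3 * pdx r x1 x2 x3
        - (I / 2) * (q x1 x2 x3) ^ 3 * (r x1 x2 x3) ^ 3) :
    ∀ x1 x2 x3, pdz L12 x1 x2 x3 + pdx L23 x1 x2 x3 + pdy L31 x1 x2 x3 = 0 := by
  have eqy : dd (0, 1, 0) q = K (I / 2) * dd (1, 0, 0) (dd (1, 0, 0) q) - K I * (q * q) * r := by
    funext x y z
    have := hq2 x y z
    simp (maxDischargeDepth := 40) only [pdx_eq, pdy_eq, hq, sm_dd] at this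
    simp only [Pi.mul_apply, Pi.sub_apply, K, this]; ring
  have ery : dd (0, 1, 0) r = K (-(I / 2)) * dd (1, 0, 0) (dd (1, 0, 0) r)
      + K I * (r * r) * q := by
    funext x y z
    have := hr2 x y z
    simp (maxDischargeDepth := 40) only [pdx_eq, pdy_eq, hr, sm_dd] at this
    simp only [Pi.mul_apply, Pi.add_apply, K, this]; ring
  have eqz : dd (0, 0, 1) q = K (3 / 2) * q * r * dd (1, 0, 0) q
      - K (1 / 4) * dd (1, 0, 0) (dd (1, 0, 0) (dd (1, 0, 0) q)) := by
    funext x y z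
    have := hq3 x y z
    simp (maxDischargeDepth := 40) only [pdx_eq, pdz_eq, hq, sm_dd] at this
    simp only [Pi.mul_apply, Pi.sub_apply, K, this]
  have erz : dd (0, 0, 1) r = K (3 / 2) * r * q * dd (1, 0, 0) r
      - K (1 / 4) * dd (1, 0, 0) (dd (1, 0, 0) (dd (1, 0, 0) r)) := by
    funext x y z
    have := hr3 x y z
    simp (maxDischargeDepth := 40) only [pdx_eq, pdz_eq, hr, sm_dd] at this
    simp only [Pi.mul_apply, Pi.sub_apply, K, this]
  have cy : ∀ {f : ℝ → ℝ → ℝ → ℂ}, Smooth3 f →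
      dd (0, 1, 0) (dd (1, 0, 0) f) = dd (1, 0, 0) (dd (0, 1, 0) f) := fun h => dd_comm _ _ h
  have cz : ∀ {f : ℝ → ℝ → ℝ → ℂ}, Smooth3 f →
      dd (0, 0, 1) (dd (1, 0, 0) f) = dd (1, 0, 0) (dd (0, 0, 1) f) := fun h => dd_comm _ _ h
  have e12 : L12 = K (1 / 2) * (r * dd (0, 1, 0) q - q * dd (0, 1, 0) r)
      + K (I / 2) * dd (1, 0, 0) q * dd (1, 0, 0) r + K (I / 2) * (q * q) * (r * r) := by
    funext x y z
    simp (maxDischargeDepth := 40) only [hL12, pdx_eq, pdy_eq, hq, hr, sm_dd, Pi.mul_apply, Pi.sub_apply, Pi.add_apply, K]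
    ring
  have e31 : L31 = K (1 / 2) * (q * dd (0, 0, 1) r - r * dd (0, 0, 1) q)
      + K (1 / 8) * (dd (1, 0, 0) r * dd (1, 0, 0) (dd (1, 0, 0) q)
        - dd (1, 0, 0) q * dd (1, 0, 0) (dd (1, 0, 0) r))
      + K (3 / 8) * q * r * (r * dd (1, 0, 0) q - q * dd (1, 0, 0) r) := by
    funext x y z
    simp (maxDischargeDepth := 40) only [hL31, pdx_eq, pdz_eq, hq, hr, sm_dd, Pi.mul_apply, Pi.sub_apply, Pi.add_apply, K]
  have e23 : L23 = K (1 / 4) * (dd (0, 1, 0) q * dd (1, 0, 0) (dd (1, 0, 0) r)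
        - dd (0, 1, 0) r * dd (1, 0, 0) (dd (1, 0, 0) q))
      - K (I / 2) * (dd (0, 0, 1) q * dd (1, 0, 0) r + dd (0, 0, 1) r * dd (1, 0, 0) q)
      + K (1 / 8) * (dd (1, 0, 0) q * dd (1, 0, 0) (dd (0, 1, 0) r)
        - dd (1, 0, 0) r * dd (1, 0, 0) (dd (0, 1, 0) q))
      + K (3 / 8) * q * r * (q * dd (0, 1, 0) r - r * dd (0, 1, 0) q)
      - K (I / 8) * dd (1, 0, 0) (dd (1, 0, 0) q) * dd (1, 0, 0) (dd (1, 0, 0) r)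
      + K (I / 4) * q * r * (q * dd (1, 0, 0) (dd (1, 0, 0) r)
        + r * dd (1, 0, 0) (dd (1, 0, 0) q))
      - K (I / 8) * ((q * q) * (dd (1, 0, 0) r * dd (1, 0, 0) r)
        + (r * r) * (dd (1, 0, 0) q * dd (1, 0, 0) q))
      + K (I / 4) * q * r * dd (1, 0, 0) q * dd (1, 0, 0) r
      - K (I / 2) * (q * q * q) * (r * r * r) := by
    funext x y z
    simp (maxDischargeDepth := 40) only [hL23, pdx_eq, pdy_eq, pdz_eq, hq, hr, sm_dd, Pi.mul_apply, Pi.sub_apply,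
      Pi.add_apply, K]
    ring
  have s12 : Smooth3 L12 := by
    rw [e12]; simp (maxDischargeDepth := 40) only [sm_add, sm_sub, sm_mul, sm_K, sm_dd, hq, hr]
  have s31 : Smooth3 L31 := by
    rw [e31]; simp (maxDischargeDepth := 40) only [sm_add, sm_sub, sm_mul, sm_K, sm_dd, hq, hr]
  have s23 : Smooth3 L23 := by
    rw [e23]; simp (maxDischargeDepth := 40) only [sm_add, sm_sub, sm_mul, sm_K, sm_dd, hq, hr]
  intro x y z
  rw [pdz_eq s12, pdx_eq s23, pdy_eq s31, e12, e31, e23]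
  simp (maxDischargeDepth := 40) only [eqy, ery, eqz, erz, cy, cz, dd_add, dd_sub, dd_mul, dd_K, sm_add, sm_sub, sm_mul,
    sm_K, sm_dd, hq, hr, zero_mul, add_zero, mul_zero, zero_add]
  simp only [Pi.mul_apply, Pi.sub_apply, Pi.add_apply, K]
  ring
end
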